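/- Let Y ⊆ ℝ² be a 2-dimensional compact connected topological (C⁰) manifold with nonempty boundary ∂Y, embedded in ℝ² (so that the manifold interior Int Y is open in ℝ²). Assume Y satisfies condition (i): for all x,y ∈ Y, ρ_Y(x,y) := liminf over x' → x, y' → y with x',y' ∈ Int Y of the infimum of the lengths of paths joining x' and y' inside Int Y, is finite. Then ρ_Y is a metric on Y (in particular, ρ_Y satisfies the triangle inequality). -/

import Mathlib

open Set Metric Filter

noncomputable section

/-- Euclidean `n`-space. -/
abbrev Euc (n : ℕ) := EuclideanSpace ℝ (Fin n)

/-- A domain: a nonempty open connected subset of Euclidean space. -/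
def IsEucDomain {n : ℕ} (U : Set (Euc n)) : Prop := IsOpen U ∧ IsConnected U

/-- Intrinsic extended distance inside `S`: the infimum of the lengths (total
variations) of continuous paths joining `x` and `y` within `S`. -/
def intrinsicDist {n : ℕ} (S : Set (Euc n)) (x y : Euc n) : ENNReal :=
  ⨅ (γ : ℝ → Euc n) (_ : ContinuousOn γ (Icc (0:ℝ) 1)) (_ : γ 0 = x) (_ : γ 1 = y)
    (_ : MapsTo γ (Icc (0:ℝ) 1) S), eVariationOn γ (Icc (0:ℝ) 1)

/-- The closed half-space `{v : x₀(v) ≥ 0}` in Euclidean `n`-space. -/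
def closedHalfSpace (n : ℕ) (hn : 0 < n) : Set (Euc n) := {v | 0 ≤ v ⟨0, hn⟩}

/-- The manifold interior of `Y ⊆ ℝⁿ`: points having a neighborhood in `Y`
homeomorphic to an open subset of `ℝⁿ`. -/
def mInterior (n : ℕ) (Y : Set (Euc n)) : Set (Euc n) :=
  {x | x ∈ Y ∧ ∃ N : Set (Euc n), N ∈ nhdsWithin x Y ∧ N ⊆ Y ∧
    ∃ O : Set (Euc n), IsOpen O ∧ Nonempty (↥N ≃ₜ ↥O)}

/-- `Y ⊆ ℝⁿ` is a topological (`C⁰`) `n`-manifold with boundary: every point has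
a neighborhood in `Y` homeomorphic to an open subset of the closed half-space. -/
def IsC0ManifoldWithBoundary (n : ℕ) (hn : 0 < n) (Y : Set (Euc n)) : Prop :=
  ∀ x ∈ Y, ∃ N : Set (Euc n), N ∈ nhdsWithin x Y ∧ N ⊆ Y ∧
    ∃ O : Set (Euc n), (∃ O' : Set (Euc n), IsOpen O' ∧ O = O' ∩ closedHalfSpace n hn) ∧
      Nonempty (↥N ≃ₜ ↥O)

/-- `ρ_Y(x,y)`: the liminf, over `x' → x`, `y' → y` with `x', y'` in the manifold
interior of `Y`, of the infimum of lengths of paths joining `x'` and `y'` within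
the manifold interior of `Y`. -/
def rhoY (n : ℕ) (Y : Set (Euc n)) (x y : Euc n) : ENNReal :=
  liminf (fun p : Euc n × Euc n => intrinsicDist (mInterior n Y) p.1 p.2)
    ((nhdsWithin x (mInterior n Y)) ×ˢ (nhdsWithin y (mInterior n Y)))

/-- A continuous nowhere vanishing complex function on the plane has a continuous logarithm. -/
lemma exists_continuous_exp_eq {f : ℝ × ℝ → ℂ} (hf : Continuous f) (h0 : ∀ p, f p ≠ 0) :
    ∃ L : ℝ × ℝ → ℂ, Continuous L ∧ ∀ p, Complex.exp (L p) = f p := by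
  obtain ⟨L, ⟨-, hL⟩, -⟩ := Complex.isCoveringMapOn_exp.existsUnique_continuousMap_lifts
    ⟨f, hf⟩ (Complex.exp_log (h0 0)) (fun p ↦ h0 p)
  exact ⟨L, L.continuous, fun p ↦ congrFun hL p⟩

lemma sub_lt_pi_of_sin_pos {g : ℝ → ℝ} (hg : Continuous g) (hs : ∀ t, 0 < Real.sin (g t))
    (s t : ℝ) : g s - g t < Real.pi := by
  by_contra! h
  have hmem : g t + Real.pi ∈ uIcc (g t) (g s) := by
    rw [mem_uIcc]; left; constructor <;> linarith [Real.pi_pos]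
  obtain ⟨u, -, hu⟩ := intermediate_value_uIcc hg.continuousOn hmem
  have := hs u
  rw [hu, Real.sin_add_pi] at this
  linarith [hs t]

lemma lt_of_sin_sub_pos {a b : ℝ} (h : a - b < Real.pi)
    (hs : 0 < Real.sin (b - a)) : a < b := by
  by_contra! hab
  linarith [Real.sin_nonpos_of_nonpos_of_neg_pi_le (x := b - a) (by linarith) (by linarith)]

/-- The Poincaré–Miranda theorem in the unit square. -/
lemma exists_common_zero_of_sides {u v : ℝ × ℝ → ℝ} (hu : Continuous u) (hv : Continuous v)
    (hul : ∀ t ∈ Icc (0 : ℝ) 1, u (0, t) < 0) (hur : ∀ t ∈ Icc (0 : ℝ) 1, 0 < u (1, t))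
    (hvb : ∀ s ∈ Icc (0 : ℝ) 1, v (s, 0) < 0) (hvt : ∀ s ∈ Icc (0 : ℝ) 1, 0 < v (s, 1)) :
    ∃ p ∈ Icc (0 : ℝ) 1 ×ˢ Icc (0 : ℝ) 1, u p = 0 ∧ v p = 0 := by
  by_contra! hne
  let c : ℝ → ℝ := fun t ↦ projIcc (0 : ℝ) 1 zero_le_one t
  have hc : Continuous c := continuous_subtype_val.comp continuous_projIcc
  have hcm : ∀ t, c t ∈ Icc (0 : ℝ) 1 := fun t ↦ (projIcc (0 : ℝ) 1 zero_le_one t).2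
  have hc0 : c 0 = 0 := by simp [c]
  have hc1 : c 1 = 1 := by simp [c]
  let f : ℝ × ℝ → ℂ := fun p ↦ ⟨u (c p.1, c p.2), v (c p.1, c p.2)⟩
  have hf : Continuous f := by
    have : f = fun p ↦ ((u (c p.1, c p.2) : ℝ) : ℂ) + (v (c p.1, c p.2) : ℝ) * Complex.I := by
      ext p
      exact Complex.mk_eq_add_mul_I _ _
    rw [this]
    fun_prop
  obtain ⟨L, hL, hLf⟩ := exists_continuous_exp_eq hf fun p h ↦
    hne (c p.1, c p.2) ⟨hcm _, hcm _⟩ (congrArg Complex.re h) (congrArg Complex.im h)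
  have hre : ∀ p, Real.exp (L p).re * Real.cos (L p).im = u (c p.1, c p.2) := fun p ↦ by
    rw [← Complex.exp_re, hLf]
  have him : ∀ p, Real.exp (L p).re * Real.sin (L p).im = v (c p.1, c p.2) := fun p ↦ by
    rw [← Complex.exp_im, hLf]
  have hT : ∀ s, 0 < Real.sin (L (s, 1)).im := fun s ↦
    pos_of_mul_pos_right (by rw [him]; simpa [hc1] using hvt _ (hcm s)) (Real.exp_pos _).le
  have hB : ∀ s, Real.sin (L (s, 0)).im < 0 := fun s ↦
    neg_of_mul_neg_right (by rw [him]; simpa [hc0] using hvb _ (hcm s)) (Real.exp_pos _).le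
  have hR : ∀ t, 0 < Real.cos (L (1, t)).im := fun t ↦
    pos_of_mul_pos_right (by rw [hre]; simpa [hc1] using hur _ (hcm t)) (Real.exp_pos _).le
  have hLe : ∀ t, Real.cos (L (0, t)).im < 0 := fun t ↦
    neg_of_mul_neg_right (by rw [hre]; simpa [hc0] using hul _ (hcm t)) (Real.exp_pos _).le
  have dT := sub_lt_pi_of_sin_pos (g := fun s ↦ (L (s, 1)).im) (by fun_prop) hT
  have dB := sub_lt_pi_of_sin_pos (g := fun s ↦ (L (s, 0)).im + Real.pi) (by fun_prop)
    (fun s ↦ by rw [Real.sin_add_pi]; linarith [hB s])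
  have dR := sub_lt_pi_of_sin_pos (g := fun t ↦ (L (1, t)).im + Real.pi / 2) (by fun_prop)
    (fun t ↦ by rw [Real.sin_add_pi_div_two]; exact hR t)
  have dL := sub_lt_pi_of_sin_pos (g := fun t ↦ (L (0, t)).im - Real.pi / 2) (by fun_prop)
    (fun t ↦ by rw [Real.sin_sub_pi_div_two]; linarith [hLe t])
  simp only [add_sub_add_right_eq_sub, sub_sub_sub_cancel_right] at dT dB dR dL
  have key1 : (L (1, 1)).im < (L (0, 1)).im := lt_of_sin_sub_pos (dT _ _) <| by
    rw [Real.sin_sub]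
    nlinarith [mul_pos (hT 0) (hR 1), mul_pos (neg_pos.2 (hLe 1)) (hT 1)]
  have key2 : (L (0, 1)).im < (L (0, 0)).im := lt_of_sin_sub_pos (dL _ _) <| by
    rw [Real.sin_sub]
    nlinarith [mul_pos (neg_pos.2 (hB 0)) (neg_pos.2 (hLe 1)), mul_pos (neg_pos.2 (hLe 0)) (hT 0)]
  have key3 : (L (0, 0)).im < (L (1, 0)).im := lt_of_sin_sub_pos (dB _ _) <| by
    rw [Real.sin_sub]
    nlinarith [mul_pos (neg_pos.2 (hB 1)) (neg_pos.2 (hLe 0)), mul_pos (hR 0) (neg_pos.2 (hB 0))]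
  have key4 : (L (1, 0)).im < (L (1, 1)).im := lt_of_sin_sub_pos (dR _ _) <| by
    rw [Real.sin_sub]
    nlinarith [mul_pos (hT 1) (hR 0), mul_pos (hR 1) (neg_pos.2 (hB 1))]
  linarith

/-- If the level set `{l = c}` in the unit square separates the left side from the right side, and
`θ` maps it into an open set `V` of the line, then some component of `V` meets the `θ`-images of
both the bottom and the top parts of the level set. -/
lemma exists_crossing_interval {l θ : ℝ × ℝ → ℝ} (hl : Continuous l) (hθ : Continuous θ) {c : ℝ}
    (hleft : ∀ t ∈ Icc (0 : ℝ) 1, l (0, t) < c) (hright : ∀ t ∈ Icc (0 : ℝ) 1, c < l (1, t))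
    {V : Set ℝ} (hV : IsOpen V)
    (hlV : ∀ p ∈ Icc (0 : ℝ) 1 ×ˢ Icc (0 : ℝ) 1, l p = c → θ p ∈ V) :
    ∃ s₁ ∈ Icc (0 : ℝ) 1, ∃ s₂ ∈ Icc (0 : ℝ) 1, l (s₁, 0) = c ∧ l (s₂, 1) = c ∧
      uIcc (θ (s₁, 0)) (θ (s₂, 1)) ⊆ V := by
  by_contra! hcon
  let Q : Set (ℝ × ℝ) := Icc (0 : ℝ) 1 ×ˢ Icc (0 : ℝ) 1
  have hQ : IsClosed Q := isClosed_Icc.prod isClosed_Icc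
  let T : Set ℝ := {x | ∃ s ∈ Icc (0 : ℝ) 1, l (s, 0) = c ∧ θ (s, 0) = x}
  let A : Set ℝ := {τ | ∃ x ∈ T, uIcc x τ ⊆ V}
  have hnear : ∀ τ ∈ V, ∀ᶠ τ' in nhds τ, uIcc τ τ' ⊆ V := by
    intro τ hτ
    obtain ⟨ε, hε, hb⟩ := Metric.isOpen_iff.1 hV τ hτ
    filter_upwards [Metric.ball_mem_nhds τ hε] with τ' hτ'
    exact ((convex_ball τ ε).ordConnected.uIcc_subset (mem_ball_self hε) hτ').trans hb
  have hAo : IsOpen A := by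
    rw [isOpen_iff_mem_nhds]
    rintro τ ⟨x, hx, hxτ⟩
    filter_upwards [hnear τ (hxτ right_mem_uIcc)] with τ' hτ'
    exact ⟨x, hx, uIcc_subset_uIcc_union_uIcc.trans (union_subset hxτ hτ')⟩
  have hBo : IsOpen (V \ A) := by
    rw [isOpen_iff_mem_nhds]
    rintro τ ⟨hτV, hτA⟩
    filter_upwards [hnear τ hτV] with τ' hτ'
    refine ⟨hτ' right_mem_uIcc, ?_⟩
    rintro ⟨x, hx, hxτ⟩
    exact hτA ⟨x, hx, uIcc_subset_uIcc_union_uIcc.trans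
      (union_subset hxτ (by rwa [uIcc_comm]))⟩
  let K : Set (ℝ × ℝ) := Q ∩ {p | l p = c}
  have hK : IsClosed K := hQ.inter (isClosed_eq hl continuous_const)
  let KA : Set (ℝ × ℝ) := {p | p.2 = 0} ∩ Q ∪ K ∩ θ ⁻¹' (V \ A)ᶜ
  let KB : Set (ℝ × ℝ) := {p | p.2 = 1} ∩ Q ∪ K ∩ θ ⁻¹' Aᶜ
  have hKA : IsClosed KA := ((isClosed_eq continuous_snd continuous_const).inter hQ).union
    (hK.inter (hBo.isClosed_compl.preimage hθ))
  have hKB : IsClosed KB := ((isClosed_eq continuous_snd continuous_const).inter hQ).union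
    (hK.inter (hAo.isClosed_compl.preimage hθ))
  have hdisj : Disjoint KA KB := by
    rw [Set.disjoint_left]
    rintro ⟨s, t⟩ (⟨h0, hq⟩ | ⟨⟨hq, hk⟩, hA⟩) (⟨h1, -⟩ | ⟨⟨hq', hk'⟩, hB⟩)
    · simp only [mem_ofPred_eq] at h0 h1
      linarith
    · simp only [mem_ofPred_eq] at h0 hk'
      subst h0
      exact hB ⟨_, ⟨s, hq.1, hk', rfl⟩, by simpa using hlV _ hq hk'⟩
    · simp only [mem_ofPred_eq] at h1 hk
      subst h1
      by_cases hm : θ (s, 1) ∈ A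
      · obtain ⟨x, ⟨s₁, hs₁, hl₁, rfl⟩, hx⟩ := hm
        exact hcon s₁ hs₁ s hq.1 hl₁ hk hx
      · exact hA ⟨hlV _ hq hk, hm⟩
    · exact hA ⟨hlV _ hq hk, hB⟩
  obtain ⟨w, hw0, hw1, -⟩ := exists_continuous_zero_one_of_isClosed hKA hKB hdisj
  have hI0 : (0 : ℝ) ∈ Icc (0 : ℝ) 1 := by simp
  have hI1 : (1 : ℝ) ∈ Icc (0 : ℝ) 1 := by simp
  obtain ⟨p, hpQ, hp1, hp2⟩ := exists_common_zero_of_sides (u := fun p ↦ l p - c)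
    (v := fun p ↦ w p - 1 / 2) (by fun_prop) (by fun_prop)
    (fun t ht ↦ by linarith [hleft t ht]) (fun t ht ↦ by linarith [hright t ht])
    (fun s hs ↦ by
      have := hw0 (show (s, 0) ∈ KA from Or.inl ⟨rfl, hs, hI0⟩)
      simp only [this]; norm_num)
    (fun s hs ↦ by
      have := hw1 (show (s, 1) ∈ KB from Or.inl ⟨rfl, hs, hI1⟩)
      simp only [this]; norm_num)
  have hpK : p ∈ K := ⟨hpQ, by simp only [mem_ofPred_eq]; linarith⟩
  by_cases hm : θ p ∈ A
  · have := hw0 (show p ∈ KA from Or.inr ⟨hpK, fun h ↦ h.2 hm⟩)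
    norm_num [this] at hp2
  · have := hw1 (show p ∈ KB from Or.inr ⟨hpK, hm⟩)
    norm_num [this] at hp2

section intrinsicDist

variable {n : ℕ} {S : Set (Euc n)}

lemma intrinsicDist_le_eVariationOn {γ : ℝ → Euc n} {a b : ℝ} (hab : a ≤ b)
    (hγ : ContinuousOn γ (Icc a b)) (hm : MapsTo γ (Icc a b) S) :
    intrinsicDist S (γ a) (γ b) ≤ eVariationOn γ (Icc a b) := by
  let φ : ℝ → ℝ := fun t ↦ a + (b - a) * t
  have hφm : MapsTo φ (Icc 0 1) (Icc a b) := fun t ht ↦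
    ⟨by simp only [φ]; nlinarith [ht.1, ht.2], by simp only [φ]; nlinarith [ht.1, ht.2]⟩
  have hφ : Monotone φ := fun s t hst ↦ by
    simp only [φ]; nlinarith
  unfold intrinsicDist
  exact iInf_le_of_le (γ ∘ φ) <| iInf_le_of_le (hγ.comp (by fun_prop) hφm) <|
    iInf_le_of_le (by simp [φ]) <| iInf_le_of_le (by simp [φ]) <|
    iInf_le_of_le (hm.comp hφm) <|
    eVariationOn.comp_le_of_monotoneOn γ φ (hφ.monotoneOn _) hφm

lemma exists_path_of_intrinsicDist_lt {x y : Euc n} {c : ENNReal}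
    (h : intrinsicDist S x y < c) :
    ∃ γ : ℝ → Euc n, ContinuousOn γ (Icc (0 : ℝ) 1) ∧ γ 0 = x ∧ γ 1 = y ∧
      MapsTo γ (Icc (0 : ℝ) 1) S ∧ eVariationOn γ (Icc (0 : ℝ) 1) < c := by
  simp only [intrinsicDist, iInf_lt_iff] at h
  obtain ⟨γ, h1, h2, h3, h4, h5⟩ := h
  exact ⟨γ, h1, h2, h3, h4, h5⟩

lemma intrinsicDist_comm_le (x y : Euc n) : intrinsicDist S x y ≤ intrinsicDist S y x := by
  refine le_of_forall_gt fun c hc ↦ ?_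
  obtain ⟨γ, h1, rfl, rfl, h4, h5⟩ := exists_path_of_intrinsicDist_lt hc
  have hm : MapsTo (fun t : ℝ ↦ 1 - t) (Icc 0 1) (Icc 0 1) := fun t ht ↦
    ⟨by linarith [ht.2], by linarith [ht.1]⟩
  have h := intrinsicDist_le_eVariationOn (γ := γ ∘ fun t ↦ 1 - t) zero_le_one
    (h1.comp (by fun_prop) hm) (h4.comp hm)
  simp only [Function.comp, sub_zero, sub_self] at h
  exact (h.trans (eVariationOn.comp_le_of_antitoneOn γ _
    (fun s _ t _ hst ↦ sub_le_sub_left hst 1) hm)).trans_lt h5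

lemma intrinsicDist_comm (x y : Euc n) : intrinsicDist S x y = intrinsicDist S y x :=
  le_antisymm (intrinsicDist_comm_le x y) (intrinsicDist_comm_le y x)

lemma intrinsicDist_triangle (x y z : Euc n) :
    intrinsicDist S x z ≤ intrinsicDist S x y + intrinsicDist S y z := by
  refine le_of_forall_gt fun c hc ↦ ?_
  obtain ⟨a, b, ha, hb, hab⟩ : ∃ a b, intrinsicDist S x y < a ∧ intrinsicDist S y z < b ∧
      a + b ≤ c := by
    obtain ⟨a, ha, b, hb, hab⟩ := ENNReal.exists_add_lt_of_add_lt hc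
    exact ⟨a, b, ha, hb, hab.le⟩
  obtain ⟨γ, h1, rfl, rfl, h4, h5⟩ := exists_path_of_intrinsicDist_lt ha
  obtain ⟨σ, k1, k2, rfl, k4, k5⟩ := exists_path_of_intrinsicDist_lt hb
  let δ : ℝ → Euc n := fun t ↦ if t ≤ 1 then γ t else σ (t - 1)
  have e1 : EqOn δ γ (Icc 0 1) := fun t ht ↦ if_pos ht.2
  have e2 : EqOn δ (σ ∘ fun t ↦ t - 1) (Icc 1 2) := fun t ht ↦ by
    rcases ht.1.eq_or_lt with rfl | h
    · simp [δ, k2]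
    · simp [δ, not_le.2 h]
  have hm : MapsTo (fun t : ℝ ↦ t - 1) (Icc 1 2) (Icc 0 1) := fun t ht ↦
    ⟨by linarith [ht.1], by linarith [ht.2]⟩
  have hU : Icc (0 : ℝ) 1 ∪ Icc 1 2 = Icc 0 2 := Icc_union_Icc_eq_Icc zero_le_one one_le_two
  have hδc : ContinuousOn δ (Icc 0 2) := by
    rw [← hU]
    exact (h1.congr e1).union_of_isClosed ((k1.comp (by fun_prop) hm).congr e2)
      isClosed_Icc isClosed_Icc
  have hδm : MapsTo δ (Icc 0 2) S := by
    rw [← hU]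
    exact (h4.congr e1.symm).union ((k4.comp hm).congr e2.symm)
  have h := intrinsicDist_le_eVariationOn zero_le_two hδc hδm
  have hs : eVariationOn δ (Icc 0 2) = eVariationOn δ (Icc 0 1) + eVariationOn δ (Icc 1 2) := by
    simpa using (eVariationOn.Icc_add_Icc δ (s := univ) (zero_le_one (α := ℝ)) one_le_two
      (mem_univ _)).symm
  rw [hs, eVariationOn.congr e1, eVariationOn.congr e2] at h
  have hδ0 : δ 0 = γ 0 := e1 (by simp)
  have hδ2 : δ 2 = σ 1 := by rw [e2 (by simp)]; norm_num
  rw [hδ0, hδ2] at h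
  refine (h.trans (add_le_add_right (eVariationOn.comp_le_of_monotoneOn σ _
    (fun s _ t _ hst ↦ by simpa using hst) hm) _)).trans_lt ?_
  exact (ENNReal.add_lt_add h5 k5).trans_le hab

lemma edist_le_intrinsicDist (x y : Euc n) : edist x y ≤ intrinsicDist S x y := by
  refine le_of_forall_gt fun c hc ↦ ?_
  obtain ⟨γ, -, rfl, rfl, -, h5⟩ := exists_path_of_intrinsicDist_lt hc
  exact (eVariationOn.edist_le γ (by simp) (by simp)).trans_lt h5

lemma intrinsicDist_self {x : Euc n} (hx : x ∈ S) : intrinsicDist S x x = 0 := by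
  have h := intrinsicDist_le_eVariationOn (S := S) (γ := fun _ ↦ x) (zero_le_one (α := ℝ))
    continuousOn_const (fun _ _ ↦ hx)
  rw [eVariationOn.constant_on ((subsingleton_singleton (a := x)).anti
    (by rintro _ ⟨_, -, rfl⟩; rfl))] at h
  exact le_antisymm h zero_le

lemma intrinsicDist_le_of_lipschitzWith {f : ℝ → Euc n} {K : NNReal} (hf : LipschitzWith K f)
    {a b : ℝ} (hm : MapsTo f (uIcc a b) S) :
    intrinsicDist S (f a) (f b) ≤ K * ENNReal.ofReal |b - a| := by
  wlog hab : a ≤ b generalizing a b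
  · rw [intrinsicDist_comm, abs_sub_comm]
    exact this (by rwa [uIcc_comm]) (le_of_not_ge hab)
  rw [uIcc_of_le hab] at hm
  refine (intrinsicDist_le_eVariationOn hab hf.continuous.continuousOn hm).trans ?_
  refine ((hf.lipschitzOnWith (s := univ)).comp_eVariationOn_le (g := id) (mapsTo_univ _ _)).trans
    ?_
  gcongr
  have := (monotone_id.monotoneOn (Icc a b)).eVariationOn_eq
    (left_mem_Icc.2 hab) (right_mem_Icc.2 hab)
  rw [inter_self] at this
  rw [this, abs_of_nonneg (sub_nonneg.2 hab), id, id]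

lemma intrinsicDist_le_of_segment_subset {x y : Euc n} (h : segment ℝ x y ⊆ S) :
    intrinsicDist S x y ≤ edist x y := by
  have hl : LipschitzWith (nndist x y) (AffineMap.lineMap x y : ℝ → Euc n) :=
    lipschitzWith_lineMap x y
  have := intrinsicDist_le_of_lipschitzWith (S := S) hl (a := 0) (b := 1) (by
    rw [uIcc_of_le zero_le_one]
    intro t ht
    exact h (segment_eq_image_lineMap ℝ x y ▸ mem_image_of_mem _ ht))
  rw [edist_nndist]
  simpa using this

end intrinsicDist

lemma symm_mem_mInterior {Y N O O' W V : Set (Euc 2)} {h2 : 0 < 2} (hNY : N ⊆ Y)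
    (hW : IsOpen W) (hWN : W ∩ Y ⊆ N) (hO' : IsOpen O') (hO : O = O' ∩ closedHalfSpace 2 h2)
    (e : N ≃ₜ O) (hV : IsOpen V)
    (hVW : ∀ v : O, (v : Euc 2) ∈ V ↔ (e.symm v : Euc 2) ∈ W)
    (v : O) (hvV : (v : Euc 2) ∈ V) (hv : 0 < (v : Euc 2) 0) :
    (e.symm v : Euc 2) ∈ mInterior 2 Y := by
  let N' : Set (Euc 2) := {q | q ∈ W ∧ ∃ hq : q ∈ N, 0 < (e ⟨q, hq⟩ : Euc 2) 0}
  have hN' : N' ⊆ N := fun q hq ↦ hq.2.1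
  have hpos : IsOpen {q : N | 0 < (e q : Euc 2) 0} :=
    isOpen_lt continuous_const (by fun_prop)
  obtain ⟨W', hW', hWW'⟩ := isOpen_induced_iff.1 hpos
  have hmem : ∀ q : N, (q : Euc 2) ∈ W' ↔ 0 < (e q : Euc 2) 0 := fun q ↦
    Set.ext_iff.1 hWW' q
  refine ⟨hNY (e.symm v).2, N', ?_, hN'.trans hNY, ?_⟩
  · have h1 : W ∩ W' ∈ nhds (e.symm v : Euc 2) := (hW.inter hW').mem_nhds
      ⟨(hVW v).1 hvV, (hmem _).2 (by simpa using hv)⟩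
    filter_upwards [mem_nhdsWithin_of_mem_nhds h1, self_mem_nhdsWithin] with q hq hqY
    exact ⟨hq.1, hWN ⟨hq.1, hqY⟩, (hmem ⟨q, _⟩).1 hq.2⟩
  · let g : N' → Euc 2 := fun q ↦ e (inclusion hN' q)
    have hg : Topology.IsEmbedding g := Topology.IsEmbedding.subtypeVal.comp
      (e.isEmbedding.comp (Topology.IsEmbedding.inclusion hN'))
    refine ⟨range g, ?_, ⟨hg.toHomeomorph⟩⟩
    have hrange : range g = V ∩ O' ∩ {u | 0 < u 0} := by
      ext u
      constructor
      · rintro ⟨⟨q, hqW, hqN, hq⟩, rfl⟩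
        have hO2 : (e ⟨q, hqN⟩ : Euc 2) ∈ O' ∩ closedHalfSpace 2 h2 := hO ▸ (e ⟨q, hqN⟩).2
        exact ⟨⟨(hVW _).2 (by simpa using hqW), hO2.1⟩, hq⟩
      · rintro ⟨⟨huV, huO⟩, hu⟩
        have huO : u ∈ O := by
          rw [hO]
          exact ⟨huO, le_of_lt (show 0 < u 0 from hu)⟩
        refine ⟨⟨e.symm ⟨u, huO⟩, (hVW ⟨u, huO⟩).1 huV, (e.symm ⟨u, huO⟩).2, ?_⟩, ?_⟩
        · simpa using hu
        · simp [g, inclusion]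
    rw [hrange]
    exact (hV.inter hO').inter (isOpen_lt continuous_const (by fun_prop))

/-- A chart around a boundary point, with values in a half-disc of the right half-plane of `ℂ`. -/
lemma exists_boundary_chart {Y : Set (Euc 2)} {h2 : 0 < 2}
    (hman : IsC0ManifoldWithBoundary 2 h2 Y) {y : Euc 2} (hy : y ∈ Y) (hyU : y ∉ mInterior 2 Y) :
    ∃ (φ : Euc 2 → ℂ) (ψ : ℂ → Euc 2) (δ η : ℝ), 0 < δ ∧ 0 < η ∧ φ y = 0 ∧ ψ 0 = y ∧
      ContinuousOn φ (Y ∩ ball y δ) ∧ ContinuousOn ψ {w | 0 ≤ w.re ∧ ‖w‖ < η} ∧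
      (∀ p ∈ Y ∩ ball y δ, 0 ≤ (φ p).re ∧ ‖φ p‖ < η ∧ ψ (φ p) = p) ∧
      ∀ w : ℂ, 0 ≤ w.re → ‖w‖ < η → ψ w ∈ Y ∧ (0 < w.re → ψ w ∈ mInterior 2 Y) ∧
        (ψ w ∈ ball y δ → φ (ψ w) = w) := by
  classical
  obtain ⟨N, hN, hNY, O, ⟨O', hO', hO⟩, ⟨e⟩⟩ := hman y hy
  obtain ⟨W, hW, hyW, hWN⟩ := mem_nhdsWithin.1 hN
  have hyN : y ∈ N := hWN ⟨hyW, hy⟩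
  obtain ⟨V, hV, hVW'⟩ := isOpen_induced_iff.1 (hW.preimage
    (continuous_subtype_val.comp e.symm.continuous))
  have hVW : ∀ v : O, (v : Euc 2) ∈ V ↔ (e.symm v : Euc 2) ∈ W := fun v ↦ Set.ext_iff.1 hVW' v
  let ι := Complex.orthonormalBasisOneI.repr
  have hι : ∀ z : ℂ, (ι z) 0 = z.re := fun z ↦ rfl
  have hιs : ∀ v : Euc 2, (ι.symm v).re = v 0 := fun v ↦ by rw [← hι, ι.apply_symm_apply]
  let b : ℂ := ι.symm (e ⟨y, hyN⟩)
  have hOH : ∀ v : O, (v : Euc 2) ∈ O' ∧ 0 ≤ (v : Euc 2) 0 := fun v ↦ by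
    have : (v : Euc 2) ∈ O' ∩ closedHalfSpace 2 h2 := hO.le v.2
    exact this
  have hbV : ι b ∈ V := by
    rw [ι.apply_symm_apply, hVW]
    simpa using hyW
  have hb0 : b.re = 0 := by
    refine le_antisymm (not_lt.1 fun hpos ↦ hyU ?_) ?_
    · have := symm_mem_mInterior hNY hW hWN hO' hO e hV hVW (e ⟨y, hyN⟩)
        (by rwa [ι.apply_symm_apply] at hbV) (by rwa [hιs] at hpos)
      simpa using this
    · rw [hιs]
      exact (hOH _).2
  let φ : Euc 2 → ℂ := fun p ↦ if h : p ∈ N then ι.symm (e ⟨p, h⟩) - b else 0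
  let ψ : ℂ → Euc 2 := fun w ↦ if h : ι (w + b) ∈ O then e.symm ⟨ι (w + b), h⟩ else y
  have hφN : ∀ p : N, φ p = ι.symm (e p) - b := fun p ↦ dif_pos p.2
  have hψO : ∀ w (h : ι (w + b) ∈ O), ψ w = e.symm ⟨ι (w + b), h⟩ := fun w h ↦ dif_pos h
  have hψφ : ∀ p : N, ψ (φ p) = p := fun p ↦ by
    have h : ι (φ p + b) = e p := by rw [hφN, sub_add_cancel, ι.apply_symm_apply]
    rw [hψO _ (h ▸ (e p).2)]
    simp [h]
  have hφψ : ∀ w, ι (w + b) ∈ O → φ (ψ w) = w := fun w h ↦ by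
    rw [hψO w h, hφN]
    simp
  have hφy : φ y = 0 := by
    rw [hφN ⟨y, hyN⟩]
    exact sub_self b
  have hφc : ContinuousOn φ N := by
    rw [continuousOn_iff_continuous_domRestrict]
    have : N.domRestrict φ = fun p : N ↦ ι.symm (e p) - b := funext hφN
    rw [this]
    fun_prop
  have hψc : ContinuousOn ψ {w | ι (w + b) ∈ O} := by
    rw [continuousOn_iff_continuous_domRestrict]
    have : Set.domRestrict {w | ι (w + b) ∈ O} ψ =
        fun w : {w | ι (w + b) ∈ O} ↦ (e.symm ⟨ι (w + b), w.2⟩ : Euc 2) := funext fun w ↦ hψO _ w.2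
    rw [this]
    fun_prop
  obtain ⟨η, hη, hηV⟩ := Metric.isOpen_iff.1 (hV.inter hO') (ι b)
    ⟨hbV, by rw [ι.apply_symm_apply]; exact (hOH _).1⟩
  have hηm : ∀ w : ℂ, ‖w‖ < η → ι (w + b) ∈ V ∩ O' := fun w hw ↦ hηV <| by
    rw [mem_ball, ι.dist_map, dist_eq_norm, add_sub_cancel_right]
    exact hw
  have hre : ∀ w : ℂ, (ι (w + b)) 0 = w.re := fun w ↦ by
    rw [hι, Complex.add_re, hb0, add_zero]
  have hηO : ∀ w : ℂ, 0 ≤ w.re → ‖w‖ < η → ι (w + b) ∈ O := fun w hw hwη ↦ by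
    rw [hO]
    exact ⟨(hηm w hwη).2, (hre w).ge.trans' hw⟩
  obtain ⟨δ, hδ, hδN⟩ : ∃ δ > 0, ∀ p ∈ Y ∩ ball y δ, p ∈ N ∧ ‖φ p‖ < η := by
    have h1 : ∀ᶠ p in nhdsWithin y N, ‖φ p‖ < η := by
      refine (hφc y hyN).norm.eventually_lt_const ?_
      simpa [hφy] using hη
    have h2 : ∀ᶠ p in nhdsWithin y Y, p ∈ N ∧ ‖φ p‖ < η := by
      exact Eventually.and hN (h1.filter_mono (nhdsWithin_le_iff.2 hN))
    obtain ⟨δ, hδ, h⟩ := Metric.mem_nhdsWithin_iff.1 h2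
    exact ⟨δ, hδ, fun p hp ↦ h ⟨hp.2, hp.1⟩⟩
  refine ⟨φ, ψ, δ, η, hδ, hη, hφy, hφy ▸ hψφ ⟨y, hyN⟩,
    hφc.mono fun p hp ↦ (hδN p hp).1, hψc.mono fun w hw ↦ hηO w hw.1 hw.2,
    fun p hp ↦ ⟨?_, (hδN p hp).2, hψφ ⟨p, (hδN p hp).1⟩⟩, fun w hw hwη ↦ ⟨?_, ?_, ?_⟩⟩
  · rw [hφN ⟨p, (hδN p hp).1⟩, Complex.sub_re, hb0, sub_zero, hιs]
    exact (hOH _).2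
  · rw [hψO w (hηO w hw hwη)]
    exact hNY (e.symm _).2
  · intro hpos
    rw [hψO w (hηO w hw hwη)]
    exact symm_mem_mInterior hNY hW hWN hO' hO e hV hVW _ (hηm w hwη).1 (by rwa [hre])
  · exact fun _ ↦ hφψ w (hηO w hw hwη)

lemma subset_closure_mInterior {Y : Set (Euc 2)} {h2 : 0 < 2}
    (hman : IsC0ManifoldWithBoundary 2 h2 Y) : Y ⊆ closure (mInterior 2 Y) := by
  intro y hy
  by_cases hyU : y ∈ mInterior 2 Y
  · exact subset_closure hyU
  obtain ⟨φ, ψ, δ, η, -, hη, -, hψ0, -, hψc, -, hψ⟩ := exists_boundary_chart hman hy hyU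
  have hmem : (0 : ℂ) ∈ closure {w : ℂ | 0 < w.re ∧ ‖w‖ < η} := by
    rw [Metric.mem_closure_iff]
    intro ε hε
    have hpos : 0 < min ε η / 2 := by positivity
    have h1 : min ε η / 2 < ε := by linarith [min_le_left ε η]
    have h3 : min ε η / 2 < η := by linarith [min_le_right ε η]
    refine ⟨((min ε η / 2 : ℝ) : ℂ), ⟨?_, ?_⟩, ?_⟩
    · rwa [Complex.ofReal_re]
    · rwa [Complex.norm_real, Real.norm_of_nonneg hpos.le]
    · rwa [dist_zero_left, Complex.norm_real, Real.norm_of_nonneg hpos.le]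
  have hc : ContinuousWithinAt ψ {w : ℂ | 0 < w.re ∧ ‖w‖ < η} 0 :=
    (hψc 0 (by simp [hη])).mono fun w hw ↦ ⟨hw.1.le, hw.2⟩
  have := hc.mem_closure hmem (t := mInterior 2 Y) fun w hw ↦
    (hψ w hw.1.le hw.2).2.1 hw.1
  rwa [hψ0] at this

/-- Two curves in the punctured closed right half-plane are joined by a homotopy whose intermediate
curves lie in the open half-plane and whose modulus stays between those of the two curves. -/
lemma exists_half_plane_homotopy {w₁ w₂ : ℝ → ℂ} (h₁ : Continuous w₁) (h₂ : Continuous w₂)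
    (hr₁ : ∀ s, 0 ≤ (w₁ s).re) (hr₂ : ∀ s, 0 ≤ (w₂ s).re) (hn₁ : ∀ s, w₁ s ≠ 0)
    (hn₂ : ∀ s, w₂ s ≠ 0) :
    ∃ F : ℝ × ℝ → ℂ, Continuous F ∧ (∀ s, F (s, 0) = w₁ s) ∧ (∀ s, F (s, 1) = w₂ s) ∧
      (∀ p, F p = w₁ p.1 ∨ F p = w₂ p.1 ∨ 0 < (F p).re) ∧
      (∀ p, ∀ m > 0, m ≤ ‖w₁ p.1‖ → m ≤ ‖w₂ p.1‖ → m ≤ ‖F p‖) ∧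
      ∀ p M, ‖w₁ p.1‖ ≤ M → ‖w₂ p.1‖ ≤ M → ‖F p‖ ≤ M := by
  let c : ℝ → ℝ := fun t ↦ projIcc (0 : ℝ) 1 zero_le_one t
  have hc : Continuous c := continuous_subtype_val.comp continuous_projIcc
  have hcm : ∀ t, c t ∈ Icc (0 : ℝ) 1 := fun t ↦ (projIcc (0 : ℝ) 1 zero_le_one t).2
  have hc0 : c 0 = 0 := by simp [c]
  have hc1 : c 1 = 1 := by simp [c]
  have hlog : ∀ w : ℝ → ℂ, Continuous w → (∀ s, 0 ≤ (w s).re) → (∀ s, w s ≠ 0) →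
      Continuous fun s ↦ Complex.log (w s) := fun w hw hr hn ↦ hw.clog fun s ↦ by
    rcases (hr s).lt_or_eq with h | h
    · exact Or.inl h
    · exact Or.inr fun him ↦ hn s (Complex.ext h.symm him)
  have hl₁ := hlog w₁ h₁ hr₁ hn₁
  have hl₂ := hlog w₂ h₂ hr₂ hn₂
  let A : ℝ × ℝ → ℝ := fun p ↦
    (1 - c p.2) * (Complex.log (w₁ p.1)).re + c p.2 * (Complex.log (w₂ p.1)).re
  let B : ℝ × ℝ → ℝ := fun p ↦ (1 - c p.2 * (1 - c p.2)) *
    ((1 - c p.2) * (Complex.log (w₁ p.1)).im + c p.2 * (Complex.log (w₂ p.1)).im)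
  let F : ℝ × ℝ → ℂ := fun p ↦ Complex.exp (A p + B p * Complex.I)
  have hFn : ∀ p, ‖F p‖ = Real.exp (A p) := fun p ↦ by simp [F, Complex.norm_exp]
  have hF0 : ∀ p : ℝ × ℝ, c p.2 = 0 → F p = w₁ p.1 := fun p hp ↦ by
    simp only [F, A, B, hp]
    simp only [sub_zero, one_mul, zero_mul, add_zero, Complex.re_add_im]
    exact Complex.exp_log (hn₁ _)
  have hF1 : ∀ p : ℝ × ℝ, c p.2 = 1 → F p = w₂ p.1 := fun p hp ↦ by
    simp only [F, A, B, hp]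
    simp only [sub_self, sub_zero, mul_zero, one_mul, zero_mul, zero_add, Complex.re_add_im]
    exact Complex.exp_log (hn₂ _)
  have hA : Continuous A := by
    have e₁ := Complex.continuous_re.comp (hl₁.comp (continuous_fst (Y := ℝ)))
    have e₂ := Complex.continuous_re.comp (hl₂.comp (continuous_fst (Y := ℝ)))
    have e₃ : Continuous fun p : ℝ × ℝ ↦ c p.2 := hc.comp continuous_snd
    exact ((continuous_const.sub e₃).mul e₁).add (e₃.mul e₂)
  have hB : Continuous B := by
    have e₁ := Complex.continuous_im.comp (hl₁.comp (continuous_fst (Y := ℝ)))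
    have e₂ := Complex.continuous_im.comp (hl₂.comp (continuous_fst (Y := ℝ)))
    have e₃ : Continuous fun p : ℝ × ℝ ↦ c p.2 := hc.comp continuous_snd
    exact (continuous_const.sub (e₃.mul (continuous_const.sub e₃))).mul
      (((continuous_const.sub e₃).mul e₁).add (e₃.mul e₂))
  refine ⟨F, by fun_prop, fun s ↦ hF0 _ hc0, fun s ↦ hF1 _ hc1, fun p ↦ ?_,
    fun p m hm hm₁ hm₂ ↦ ?_, fun p M hM₁ hM₂ ↦ ?_⟩
  · obtain ⟨ht0, ht1⟩ := hcm p.2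
    rcases ht0.eq_or_lt with h0 | h0
    · exact Or.inl (hF0 p h0.symm)
    rcases ht1.eq_or_lt with h1 | h1
    · exact Or.inr (Or.inl (hF1 p h1))
    refine Or.inr (Or.inr ?_)
    have hre : (F p).re = Real.exp (A p) * Real.cos (B p) := by simp [F, Complex.exp_re]
    rw [hre]
    have ha₁ := abs_le.1 (Complex.abs_arg_le_pi_div_two_iff.2 (hr₁ p.1))
    have ha₂ := abs_le.1 (Complex.abs_arg_le_pi_div_two_iff.2 (hr₂ p.1))
    rw [← Complex.log_im] at ha₁ ha₂
    have hk : 0 < c p.2 * (1 - c p.2) := mul_pos h0 (by linarith)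
    have hk' : c p.2 * (1 - c p.2) < 1 := by nlinarith
    have hC : |(1 - c p.2) * (Complex.log (w₁ p.1)).im + c p.2 * (Complex.log (w₂ p.1)).im| ≤
        Real.pi / 2 := by
      rw [abs_le]
      constructor <;> nlinarith
    have hB : |B p| < Real.pi / 2 := by
      simp only [B]
      rw [abs_mul, abs_of_pos (by linarith : 0 < 1 - c p.2 * (1 - c p.2))]
      nlinarith [Real.pi_pos]
    exact mul_pos (Real.exp_pos _) (Real.cos_pos_of_mem_Ioo (abs_lt.1 hB))
  · obtain ⟨ht0, ht1⟩ := hcm p.2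
    rw [hFn, ← Real.log_le_iff_le_exp hm]
    have e₁ := Real.log_le_log hm hm₁
    have e₂ := Real.log_le_log hm hm₂
    simp only [A, Complex.log_re]
    nlinarith
  · obtain ⟨ht0, ht1⟩ := hcm p.2
    have p₁ := norm_pos_iff.2 (hn₁ p.1)
    have p₂ := norm_pos_iff.2 (hn₂ p.1)
    rw [hFn, ← Real.le_log_iff_exp_le (p₁.trans_le hM₁)]
    have e₁ := Real.log_le_log p₁ hM₁
    have e₂ := Real.log_le_log p₂ hM₂
    simp only [A, Complex.log_re]
    nlinarith

lemma exists_first_hit {f : ℝ → ℝ} (hf : ContinuousOn f (Icc 0 1)) {c : ℝ} (h0 : f 0 ≤ c)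
    (h1 : c ≤ f 1) : ∃ s ∈ Icc (0 : ℝ) 1, f s = c ∧ ∀ t ∈ Icc 0 s, f t ≤ c := by
  have hK : IsCompact (Icc (0 : ℝ) 1 ∩ f ⁻¹' {c}) :=
    isCompact_Icc.of_isClosed_subset
      (hf.preimage_isClosed_of_isClosed isClosed_Icc isClosed_singleton) inter_subset_left
  obtain ⟨u, hu, huc⟩ := intermediate_value_Icc zero_le_one hf ⟨h0, h1⟩
  obtain ⟨s, ⟨hs, hsc⟩, hleast⟩ := hK.exists_isLeast ⟨u, hu, huc⟩
  refine ⟨s, hs, hsc, fun t ht ↦ ?_⟩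
  by_contra! hct
  obtain ⟨v, hv, hvc⟩ := intermediate_value_Icc ht.1
    (hf.mono (Icc_subset_Icc_right (ht.2.trans hs.2))) ⟨h0, hct.le⟩
  have hsv : s ≤ v := hleast ⟨⟨hv.1, hv.2.trans (ht.2.trans hs.2)⟩, hvc⟩
  have : v = t := le_antisymm hv.2 (ht.2.trans hsv)
  subst this
  exact hct.ne' hvc

/-- The initial part of a path up to the first time it leaves a ball, reparametrized. -/
lemma exists_initial_part {n : ℕ} {γ : ℝ → Euc n} (hγ : ContinuousOn γ (Icc (0 : ℝ) 1))
    {y : Euc n} {d : ℝ} (h0 : dist (γ 0) y ≤ d) (h1 : d ≤ dist (γ 1) y) :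
    ∃ σ : ℝ → Euc n, Continuous σ ∧ σ 0 = γ 0 ∧ dist (σ 1) y = d ∧
      ∀ s, dist (σ s) y ≤ d ∧ ∃ t ∈ Icc (0 : ℝ) 1, σ s = γ t := by
  obtain ⟨a, ha, had, hle⟩ := exists_first_hit (f := fun t ↦ dist (γ t) y)
    (continuous_dist.comp_continuousOn (hγ.prodMk continuousOn_const)) h0 h1
  let c : ℝ → ℝ := fun t ↦ projIcc (0 : ℝ) 1 zero_le_one t
  have hc : Continuous c := continuous_subtype_val.comp continuous_projIcc
  have hcm : ∀ t, c t ∈ Icc (0 : ℝ) 1 := fun t ↦ (projIcc (0 : ℝ) 1 zero_le_one t).2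
  have hac : ∀ s, a * c s ∈ Icc 0 a := fun s ↦
    ⟨mul_nonneg ha.1 (hcm s).1, mul_le_of_le_one_right ha.1 (hcm s).2⟩
  have hac' : ∀ s, a * c s ∈ Icc (0 : ℝ) 1 := fun s ↦ Icc_subset_Icc_right ha.2 (hac s)
  refine ⟨fun s ↦ γ (a * c s), hγ.comp_continuous (by fun_prop) hac', by simp [c], ?_,
    fun s ↦ ⟨hle _ (hac s), _, hac' s, rfl⟩⟩
  simpa [c] using had

lemma intrinsicDist_circle_le {S : Set (Euc 2)} {y : Euc 2} {r θ₁ θ₂ : ℝ} (hr : 0 ≤ r)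
    (h : ∀ θ ∈ uIcc θ₁ θ₂, y + Complex.orthonormalBasisOneI.repr (circleMap 0 r θ) ∈ S) :
    intrinsicDist S (y + Complex.orthonormalBasisOneI.repr (circleMap 0 r θ₁))
      (y + Complex.orthonormalBasisOneI.repr (circleMap 0 r θ₂)) ≤
      ENNReal.ofReal (2 * Real.pi * r) := by
  wlog hle : θ₁ ≤ θ₂ generalizing θ₁ θ₂
  · rw [intrinsicDist_comm]
    exact this (by rwa [uIcc_comm]) (le_of_not_ge hle)
  let f : ℝ → Euc 2 := fun θ ↦ y + Complex.orthonormalBasisOneI.repr (circleMap 0 r θ)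
  have hf : LipschitzWith (Real.nnabs r) f := by
    refine LipschitzWith.of_dist_le_mul fun a b ↦ ?_
    simp only [f, dist_add_left, LinearIsometryEquiv.dist_map]
    exact (lipschitzWith_circleMap 0 r).dist_le_mul a b
  obtain ⟨θ, hθ₁, hθ, hθ₂, hfθ⟩ : ∃ θ, θ₁ ≤ θ ∧ θ ≤ θ₁ + 2 * Real.pi ∧ θ ≤ θ₂ ∧ f θ = f θ₂ := by
    rcases le_or_gt θ₂ (θ₁ + 2 * Real.pi) with hlt | hgt
    · exact ⟨θ₂, hle, hlt, le_rfl, rfl⟩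
    · have hm := toIcoMod_mem_Ico Real.two_pi_pos θ₁ θ₂
      refine ⟨toIcoMod Real.two_pi_pos θ₁ θ₂, hm.1, hm.2.le, hm.2.le.trans hgt.le, ?_⟩
      simp only [f, toIcoMod, (periodic_circleMap 0 r).sub_zsmul_eq]
  change intrinsicDist S (f θ₁) (f θ₂) ≤ _
  rw [← hfθ]
  refine (intrinsicDist_le_of_lipschitzWith hf fun t ht ↦
    h t (uIcc_subset_uIcc_left ⟨by simp [hle, hθ₁], by simp [hle, hθ₂]⟩ ht)).trans ?_
  have hcoe : (Real.nnabs r : ENNReal) = ENNReal.ofReal r := by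
    rw [Real.nnabs_of_nonneg hr]; rfl
  rw [hcoe, ← ENNReal.ofReal_mul hr]
  refine ENNReal.ofReal_le_ofReal ?_
  rw [abs_of_nonneg (by linarith)]
  nlinarith

/-- Near a boundary point `y`, any two paths that start close to `y` and leave a fixed ball around
`y` can be linked by a short circular arc centred at `y`. -/
lemma exists_short_link {Y : Set (Euc 2)} {h2 : 0 < 2} (hman : IsC0ManifoldWithBoundary 2 h2 Y)
    (hopen : IsOpen (mInterior 2 Y)) {y : Euc 2} (hy : y ∈ Y) (hyU : y ∉ mInterior 2 Y)
    {d ε : ℝ} (hd : 0 < d) (hε : 0 < ε) :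
    ∃ r₀ > 0, ∀ γ₁ γ₂ : ℝ → Euc 2,
      ContinuousOn γ₁ (Icc (0 : ℝ) 1) → MapsTo γ₁ (Icc (0 : ℝ) 1) (mInterior 2 Y) →
      ContinuousOn γ₂ (Icc (0 : ℝ) 1) → MapsTo γ₂ (Icc (0 : ℝ) 1) (mInterior 2 Y) →
      dist (γ₁ 0) y < r₀ → dist (γ₂ 0) y < r₀ → d ≤ dist (γ₁ 1) y → d ≤ dist (γ₂ 1) y →
      ∃ s₁ ∈ Icc (0 : ℝ) 1, ∃ s₂ ∈ Icc (0 : ℝ) 1,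
        intrinsicDist (mInterior 2 Y) (γ₁ s₁) (γ₂ s₂) ≤ ENNReal.ofReal ε := by
  obtain ⟨φ, ψ, δ, η, hδ, hη, hφy, hψ0, hφc, hψc, hφ, hψ⟩ := exists_boundary_chart hman hy hyU
  have hUY : mInterior 2 Y ⊆ Y := fun p hp ↦ hp.1
  have hyδ : y ∈ Y ∩ ball y δ := ⟨hy, mem_ball_self hδ⟩
  have hψsmall : ∀ ρ > 0, ∃ κ > 0, ∀ w : ℂ, 0 ≤ w.re → ‖w‖ < η → ‖w‖ < κ →
      dist (ψ w) y < ρ := fun ρ hρ ↦ by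
    obtain ⟨κ, hκ, h⟩ := Metric.continuousOn_iff.1 hψc 0 (by simp [hη]) ρ hρ
    exact ⟨κ, hκ, fun w h0 h1 h2 ↦ by simpa [hψ0] using h w ⟨h0, h1⟩ (by simpa using h2)⟩
  have hφsmall : ∀ ρ > 0, ∃ κ > 0, ∀ p ∈ Y ∩ ball y δ, dist p y < κ → ‖φ p‖ < ρ :=
    fun ρ hρ ↦ by
    obtain ⟨κ, hκ, h⟩ := Metric.continuousOn_iff.1 hφc y hyδ ρ hρ
    exact ⟨κ, hκ, fun p hp hpκ ↦ by simpa [hφy] using h p hp hpκ⟩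
  obtain ⟨d', hd', hd'd, hd'δ⟩ : ∃ d' > 0, d' ≤ d ∧ d' < δ :=
    ⟨min d (δ / 2), by positivity, min_le_left _ _, (min_le_right _ _).trans_lt (by linarith)⟩
  obtain ⟨η₁, hη₁, hη₁ψ⟩ := hψsmall d' hd'
  obtain ⟨κ₁, hκ₁, hκ₁φ⟩ := hφsmall η₁ hη₁
  obtain ⟨r, hr, hrε, hrκ, hrδ⟩ : ∃ r > 0, 2 * Real.pi * r ≤ ε ∧ r < κ₁ ∧ r < δ := by
    refine ⟨min (ε / (2 * Real.pi)) (min (κ₁ / 2) (δ / 2)), by positivity, ?_, ?_, ?_⟩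
    · rw [mul_comm, ← le_div_iff₀ (by positivity)]
      exact min_le_left _ _
    · exact ((min_le_right _ _).trans (min_le_left _ _)).trans_lt (by linarith)
    · exact ((min_le_right _ _).trans (min_le_right _ _)).trans_lt (by linarith)
  obtain ⟨η₂, hη₂, hη₂ψ⟩ := hψsmall r hr
  obtain ⟨κ₂, hκ₂, hκ₂φ⟩ := hφsmall (min η₂ η) (by positivity)
  refine ⟨min κ₂ d', by positivity, fun γ₁ γ₂ c₁ m₁ c₂ m₂ n₁ n₂ f₁ f₂ ↦ ?_⟩
  have hpart : ∀ γ : ℝ → Euc 2, ContinuousOn γ (Icc (0 : ℝ) 1) →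
      MapsTo γ (Icc (0 : ℝ) 1) (mInterior 2 Y) → dist (γ 0) y < min κ₂ d' → d ≤ dist (γ 1) y →
      ∃ σ : ℝ → Euc 2, (∀ s, ∃ t ∈ Icc (0 : ℝ) 1, σ s = γ t) ∧ Continuous (φ ∘ σ) ∧
        (∀ s, σ s ∈ mInterior 2 Y ∧ 0 ≤ (φ (σ s)).re ∧ φ (σ s) ≠ 0 ∧ ‖φ (σ s)‖ < η ∧
          ψ (φ (σ s)) = σ s) ∧ ‖φ (σ 0)‖ < min η₂ η ∧ η₁ ≤ ‖φ (σ 1)‖ := by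
    intro γ hγ hm h0 h1
    obtain ⟨σ, hσ, hσ0, hσ1, hσγ⟩ := exists_initial_part hγ (h0.le.trans (min_le_right _ _))
      (hd'd.trans h1)
    have hσU : ∀ s, σ s ∈ mInterior 2 Y := fun s ↦ by
      obtain ⟨t, ht, hst⟩ := (hσγ s).2
      exact hst ▸ hm ht
    have hσδ : ∀ s, σ s ∈ Y ∩ ball y δ := fun s ↦ ⟨hUY (hσU s), (hσγ s).1.trans_lt hd'δ⟩
    refine ⟨σ, fun s ↦ (hσγ s).2, hφc.comp_continuous hσ hσδ, fun s ↦
      ⟨hσU s, (hφ _ (hσδ s)).1, fun h ↦ ?_, (hφ _ (hσδ s)).2⟩, ?_, ?_⟩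
    · have := (hφ _ (hσδ s)).2.2
      rw [h, hψ0] at this
      exact hyU (this ▸ hσU s)
    · exact hκ₂φ _ (hσδ 0) (hσ0 ▸ h0.trans_le (min_le_left _ _))
    · by_contra! hlt
      have := hη₁ψ _ (hφ _ (hσδ 1)).1 (hφ _ (hσδ 1)).2.1 hlt
      rw [(hφ _ (hσδ 1)).2.2, hσ1] at this
      exact lt_irrefl _ this
  obtain ⟨σ₁, hσγ₁, hw₁, hσ₁, hs₁, hb₁⟩ := hpart γ₁ c₁ m₁ n₁ f₁
  obtain ⟨σ₂, hσγ₂, hw₂, hσ₂, hs₂, hb₂⟩ := hpart γ₂ c₂ m₂ n₂ f₂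
  obtain ⟨F, hF, hF0, hF1, hFU, hFge, hFle⟩ := exists_half_plane_homotopy hw₁ hw₂
    (fun s ↦ (hσ₁ s).2.1) (fun s ↦ (hσ₂ s).2.1) (fun s ↦ (hσ₁ s).2.2.1) (fun s ↦ (hσ₂ s).2.2.1)
  have hFη : ∀ p, ‖F p‖ < η := fun p ↦
    (hFle p _ (le_max_left _ _) (le_max_right _ _)).trans_lt
      (max_lt (hσ₁ p.1).2.2.2.1 (hσ₂ p.1).2.2.2.1)
  have hFre : ∀ p, 0 ≤ (F p).re := fun p ↦ by
    rcases hFU p with h | h | h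
    · exact h ▸ (hσ₁ p.1).2.1
    · exact h ▸ (hσ₂ p.1).2.1
    · exact h.le
  have hψF : ∀ p, ψ (F p) ∈ mInterior 2 Y := fun p ↦ by
    rcases hFU p with h | h | h
    · rw [h, Function.comp, (hσ₁ p.1).2.2.2.2]
      exact (hσ₁ p.1).1
    · rw [h, Function.comp, (hσ₂ p.1).2.2.2.2]
      exact (hσ₂ p.1).1
    · exact (hψ _ (hFre p) (hFη p)).2.1 h
  let ι := Complex.orthonormalBasisOneI.repr
  have hG : Continuous fun p ↦ ι.symm (ψ (F p) - y) := ι.symm.continuous.comp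
    ((hψc.comp_continuous hF fun p ↦ ⟨hFre p, hFη p⟩).sub continuous_const)
  obtain ⟨L, hL, hLG⟩ := exists_continuous_exp_eq hG fun p h ↦ by
    rw [map_eq_zero_iff _ ι.symm.injective, sub_eq_zero] at h
    exact hyU (h ▸ hψF p)
  have hLψ : ∀ p, y + ι (Complex.exp (L p)) = ψ (F p) := fun p ↦ by simp [hLG]
  have hLn : ∀ p, Real.exp (L p).re = dist (ψ (F p)) y := fun p ↦ by
    rw [← Complex.norm_exp, hLG, ι.symm.norm_map, dist_eq_norm]
  have hLc : ∀ p, (L p).re = Real.log r → Complex.exp (L p) = circleMap 0 r (L p).im := by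
    intro p hp
    conv_lhs => rw [← Complex.re_add_im (L p), Complex.exp_add, hp, ← Complex.ofReal_exp,
      Real.exp_log hr]
    simp [circleMap]
  have hV : IsOpen {θ : ℝ | y + ι (circleMap 0 r θ) ∈ mInterior 2 Y} :=
    hopen.preimage (by fun_prop)
  obtain ⟨a₁, -, a₂, -, ha₁, ha₂, hsub⟩ := exists_crossing_interval (l := fun p ↦ (L p).re)
    (θ := fun p ↦ (L p).im) (c := Real.log r) (by fun_prop) (by fun_prop)
    (fun t _ ↦ by
      rw [Real.lt_log_iff_exp_lt hr, hLn]
      exact hη₂ψ _ (hFre _) (hFη _) ((hFle (0, t) _ (le_max_left _ _) (le_max_right _ _)).trans_lt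
        (max_lt (hs₁.trans_le (min_le_left _ _)) (hs₂.trans_le (min_le_left _ _)))))
    (fun t _ ↦ by
      rw [Real.log_lt_iff_lt_exp hr, hLn]
      by_contra! hle
      have hmem : ψ (F (1, t)) ∈ Y ∩ ball y δ := ⟨hUY (hψF _), hle.trans_lt hrδ⟩
      have h1 := hκ₁φ _ hmem (hle.trans_lt hrκ)
      rw [(hψ _ (hFre _) (hFη _)).2.2 hmem.2] at h1
      exact h1.not_ge (hFge (1, t) _ hη₁ hb₁ hb₂))
    hV
    (fun p _ hp ↦ by
      rw [mem_ofPred_eq, ← hLc p hp, hLψ]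
      exact hψF p)
  obtain ⟨t₁, ht₁, e₁⟩ := hσγ₁ a₁
  obtain ⟨t₂, ht₂, e₂⟩ := hσγ₂ a₂
  refine ⟨t₁, ht₁, t₂, ht₂, ?_⟩
  have key := intrinsicDist_circle_le hr.le hsub
  change intrinsicDist _ (y + ι _) (y + ι _) ≤ _ at key
  rw [← hLc _ ha₁, ← hLc _ ha₂, hLψ, hLψ, hF0, hF1, Function.comp, Function.comp,
    (hσ₁ a₁).2.2.2.2, (hσ₂ a₂).2.2.2.2, e₁, e₂] at key
  exact key.trans (ENNReal.ofReal_le_ofReal hrε)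

lemma edist_le_rhoY {n : ℕ} {Y : Set (Euc n)} (x y : Euc n) : edist x y ≤ rhoY n Y x y := by
  by_contra! h
  obtain ⟨c, hc, hcd⟩ := exists_between h
  have hfreq := frequently_lt_of_liminf_lt (by isBoundedDefault) hc
  have hev : ∀ᶠ p in nhdsWithin x (mInterior n Y) ×ˢ nhdsWithin y (mInterior n Y),
      c < edist p.1 p.2 := by
    have : Tendsto (fun p : Euc n × Euc n ↦ edist p.1 p.2)
        (nhdsWithin x (mInterior n Y) ×ˢ nhdsWithin y (mInterior n Y)) (nhds (edist x y)) := by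
      refine Tendsto.mono_left (continuous_edist.tendsto (x, y)) ?_
      rw [nhds_prod_eq]
      exact prod_mono nhdsWithin_le_nhds nhdsWithin_le_nhds
    exact this.eventually_const_lt hcd
  obtain ⟨p, hp, hp'⟩ := (hfreq.and_eventually hev).exists
  exact (hp'.trans_le (edist_le_intrinsicDist _ _)).not_gt hp


/-- Values of `intrinsicDist` just above `ρ_Y(x, y)` are attained arbitrarily close to `(x, y)`. -/
lemma exists_intrinsicDist_lt_of_rhoY_lt {n : ℕ} {Y : Set (Euc n)} {x y : Euc n} {c : ENNReal}
    (h : rhoY n Y x y < c) {δ : ℝ} (hδ : 0 < δ) :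
    ∃ x' ∈ mInterior n Y, ∃ y' ∈ mInterior n Y, dist x' x < δ ∧ dist y' y < δ ∧
      intrinsicDist (mInterior n Y) x' y' < c := by
  have hfreq := frequently_lt_of_liminf_lt (by isBoundedDefault) h
  have hmem : ∀ u : Euc n, ball u δ ∩ mInterior n Y ∈ nhdsWithin u (mInterior n Y) := fun u ↦
    inter_mem (mem_nhdsWithin_of_mem_nhds (ball_mem_nhds u hδ)) self_mem_nhdsWithin
  obtain ⟨p, hp, hx, hy⟩ := (hfreq.and_eventually (prod_mem_prod (hmem x) (hmem y))).exists
  exact ⟨p.1, hx.2, p.2, hy.2, hx.1, hy.1, hp⟩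

lemma rhoY_le_of_forall {n : ℕ} {Y : Set (Euc n)} {x y : Euc n} {c : ENNReal}
    (h : ∀ δ > 0, ∃ x' ∈ mInterior n Y, ∃ y' ∈ mInterior n Y, dist x' x < δ ∧ dist y' y < δ ∧
      intrinsicDist (mInterior n Y) x' y' ≤ c) : rhoY n Y x y ≤ c := by
  refine liminf_le_of_frequently_le ?_ (by isBoundedDefault)
  refine frequently_iff.2 fun {s} hs ↦ ?_
  obtain ⟨A, hA, B, hB, hAB⟩ := mem_prod_iff.1 hs
  obtain ⟨α, hα, hαA⟩ := Metric.mem_nhdsWithin_iff.1 hA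
  obtain ⟨β, hβ, hβB⟩ := Metric.mem_nhdsWithin_iff.1 hB
  obtain ⟨x', hx', y', hy', hxd, hyd, hc⟩ := h (min α β) (lt_min hα hβ)
  exact ⟨(x', y'), hAB ⟨hαA ⟨hxd.trans_le (min_le_left _ _), hx'⟩,
    hβB ⟨hyd.trans_le (min_le_right _ _), hy'⟩⟩, hc⟩

lemma rhoY_comm_le {n : ℕ} {Y : Set (Euc n)} (x y : Euc n) : rhoY n Y x y ≤ rhoY n Y y x := by
  refine le_of_forall_gt_imp_ge_of_dense fun c hc ↦ rhoY_le_of_forall fun δ hδ ↦ ?_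
  obtain ⟨y', hy', x', hx', hyd, hxd, h⟩ := exists_intrinsicDist_lt_of_rhoY_lt hc hδ
  exact ⟨x', hx', y', hy', hxd, hyd, (intrinsicDist_comm x' y').trans_le h.le⟩

lemma rhoY_self {Y : Set (Euc 2)} {h2 : 0 < 2} (hman : IsC0ManifoldWithBoundary 2 h2 Y)
    {x : Euc 2} (hx : x ∈ Y) : rhoY 2 Y x x = 0 := by
  refine le_antisymm (rhoY_le_of_forall fun δ hδ ↦ ?_) zero_le
  obtain ⟨x', hx', hd⟩ := Metric.mem_closure_iff.1 (subset_closure_mInterior hman hx) δ hδ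
  rw [dist_comm] at hd
  exact ⟨x', hx', x', hx', hd, hd, (intrinsicDist_self hx').le⟩

/-- Points near `y` in the interior can be linked, along given interior paths to points away from
`y`, at an arbitrarily small cost. -/
lemma exists_intrinsicDist_le_add {Y : Set (Euc 2)} {h2 : 0 < 2}
    (hman : IsC0ManifoldWithBoundary 2 h2 Y) (hopen : IsOpen (mInterior 2 Y)) {y : Euc 2}
    (hy : y ∈ Y) {d ε : ℝ} (hd : 0 < d) (hε : 0 < ε) :
    ∃ r₀ > 0, ∀ x' y' y'' z' : Euc 2,
      dist y' y < r₀ → dist y'' y < r₀ → d ≤ dist x' y → d ≤ dist z' y →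
      ∀ a b : ENNReal, intrinsicDist (mInterior 2 Y) x' y' < a →
        intrinsicDist (mInterior 2 Y) y'' z' < b →
        intrinsicDist (mInterior 2 Y) x' z' ≤ a + ENNReal.ofReal ε + b := by
  by_cases hyU : y ∈ mInterior 2 Y
  · obtain ⟨ρ, hρ, hball⟩ := Metric.isOpen_iff.1 hopen y hyU
    refine ⟨min ρ (ε / 2), by positivity, fun x' y' y'' z' h' h'' _ _ a b ha hb ↦ ?_⟩
    have hseg : segment ℝ y' y'' ⊆ mInterior 2 Y := ((convex_ball y ρ).segment_subset
      (h'.trans_le (min_le_left _ _)) (h''.trans_le (min_le_left _ _))).trans hball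
    have hlink : intrinsicDist (mInterior 2 Y) y' y'' ≤ ENNReal.ofReal ε := by
      refine (intrinsicDist_le_of_segment_subset hseg).trans ?_
      rw [edist_dist]
      refine ENNReal.ofReal_le_ofReal ((dist_triangle_right y' y'' y).trans ?_)
      linarith [min_le_right ρ (ε / 2)]
    calc intrinsicDist (mInterior 2 Y) x' z'
        ≤ intrinsicDist (mInterior 2 Y) x' y' + intrinsicDist (mInterior 2 Y) y' y''
          + intrinsicDist (mInterior 2 Y) y'' z' :=
          (intrinsicDist_triangle _ y'' _).trans
            (add_le_add_left (intrinsicDist_triangle _ _ _) _)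
      _ ≤ a + ENNReal.ofReal ε + b := by gcongr
  · obtain ⟨r₀, hr₀, hlink⟩ := exists_short_link hman hopen hy hyU hd hε
    refine ⟨r₀, hr₀, fun x' y' y'' z' h' h'' hx hz a b ha hb ↦ ?_⟩
    rw [intrinsicDist_comm] at ha
    obtain ⟨γ₁, c₁, rfl, rfl, m₁, l₁⟩ := exists_path_of_intrinsicDist_lt ha
    obtain ⟨γ₂, c₂, rfl, rfl, m₂, l₂⟩ := exists_path_of_intrinsicDist_lt hb
    obtain ⟨s₁, hs₁, s₂, hs₂, hs⟩ := hlink γ₁ γ₂ c₁ m₁ c₂ m₂ h' h'' hx hz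
    have htail : ∀ γ : ℝ → Euc 2, ContinuousOn γ (Icc (0 : ℝ) 1) →
        MapsTo γ (Icc (0 : ℝ) 1) (mInterior 2 Y) → ∀ s ∈ Icc (0 : ℝ) 1,
        intrinsicDist (mInterior 2 Y) (γ s) (γ 1) ≤ eVariationOn γ (Icc 0 1) :=
      fun γ c m s hs ↦ (intrinsicDist_le_eVariationOn hs.2 (c.mono (Icc_subset_Icc_left hs.1))
        (m.mono_left (Icc_subset_Icc_left hs.1))).trans
        (eVariationOn.mono _ (Icc_subset_Icc_left hs.1))
    have h₁ := (htail γ₁ c₁ m₁ s₁ hs₁).trans l₁.le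
    have h₂ := (htail γ₂ c₂ m₂ s₂ hs₂).trans l₂.le
    rw [intrinsicDist_comm] at h₁
    calc intrinsicDist (mInterior 2 Y) (γ₁ 1) (γ₂ 1)
        ≤ intrinsicDist (mInterior 2 Y) (γ₁ 1) (γ₁ s₁)
          + intrinsicDist (mInterior 2 Y) (γ₁ s₁) (γ₂ s₂)
          + intrinsicDist (mInterior 2 Y) (γ₂ s₂) (γ₂ 1) :=
          (intrinsicDist_triangle _ (γ₂ s₂) _).trans
            (add_le_add_left (intrinsicDist_triangle _ _ _) _)
      _ ≤ a + ENNReal.ofReal ε + b := by gcongr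

lemma rhoY_triangle {Y : Set (Euc 2)} {h2 : 0 < 2} (hman : IsC0ManifoldWithBoundary 2 h2 Y)
    (hopen : IsOpen (mInterior 2 Y)) {y : Euc 2} (hy : y ∈ Y) (x z : Euc 2) :
    rhoY 2 Y x z ≤ rhoY 2 Y x y + rhoY 2 Y y z := by
  rcases eq_or_ne x y with rfl | hxy
  · exact le_add_self
  rcases eq_or_ne z y with rfl | hzy
  · exact le_self_add
  refine le_of_forall_gt_imp_ge_of_dense fun c hc ↦ ?_
  obtain ⟨a, ha, b, hb, hab⟩ := ENNReal.exists_add_lt_of_add_lt hc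
  obtain ⟨ε, hε, hεc⟩ := ENNReal.lt_iff_exists_add_pos_lt.1 hab
  obtain ⟨d, hd, hdx, hdz⟩ : ∃ d > 0, 2 * d ≤ dist x y ∧ 2 * d ≤ dist z y := by
    have h1 := dist_pos.2 hxy
    have h2 := dist_pos.2 hzy
    exact ⟨min (dist x y) (dist z y) / 2, by positivity,
      by linarith [min_le_left (dist x y) (dist z y)],
      by linarith [min_le_right (dist x y) (dist z y)]⟩
  obtain ⟨r₀, hr₀, hlink⟩ := exists_intrinsicDist_le_add hman hopen hy hd
    (NNReal.coe_pos.2 hε)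
  refine rhoY_le_of_forall fun δ hδ ↦ ?_
  have hpos : 0 < min δ (min d r₀) := by positivity
  have hδd : min δ (min d r₀) ≤ d := (min_le_right _ _).trans (min_le_left _ _)
  have hδr : min δ (min d r₀) ≤ r₀ := (min_le_right _ _).trans (min_le_right _ _)
  obtain ⟨x', hx', y', hy', hxd, hyd, h₁⟩ := exists_intrinsicDist_lt_of_rhoY_lt ha hpos
  obtain ⟨y'', hy'', z', hz', hyd', hzd, h₂⟩ := exists_intrinsicDist_lt_of_rhoY_lt hb hpos
  refine ⟨x', hx', z', hz', hxd.trans_le (min_le_left _ _), hzd.trans_le (min_le_left _ _),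
    (hlink x' y' y'' z' (hyd.trans_le hδr) (hyd'.trans_le hδr) ?_ ?_ a b h₁ h₂).trans ?_⟩
  · linarith [dist_triangle_left x y x']
  · linarith [dist_triangle_left z y z']
  · rw [ENNReal.ofReal_coe_nnreal, add_right_comm]
    exact hεc.le

/-- Theorem 3.1 (Euclidean case): for a compact connected `C⁰` 2-manifold with
nonempty boundary `Y ⊆ ℝ²` (with open manifold interior) satisfying condition
(i), the function `ρ_Y` is a metric on `Y`. -/
theorem rhoY_is_metric_dim_two
    (Y : Set (Euc 2)) (hcomp : IsCompact Y) (hconn : IsConnected Y)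
    (hman : IsC0ManifoldWithBoundary 2 (by norm_num) Y)
    (hopen : IsOpen (mInterior 2 Y))
    (hbd : (Y \ mInterior 2 Y).Nonempty)
    (hfin : ∀ x ∈ Y, ∀ y ∈ Y, rhoY 2 Y x y < ⊤) :
    (∀ x ∈ Y, ∀ y ∈ Y, (rhoY 2 Y x y = 0 ↔ x = y)) ∧
    (∀ x ∈ Y, ∀ y ∈ Y, rhoY 2 Y x y = rhoY 2 Y y x) ∧
    (∀ x ∈ Y, ∀ y ∈ Y, ∀ z ∈ Y, rhoY 2 Y x z ≤ rhoY 2 Y x y + rhoY 2 Y y z) := by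
  refine ⟨fun x hx y _ ↦ ⟨fun h ↦ ?_, ?_⟩, fun x _ y _ ↦
    le_antisymm (rhoY_comm_le x y) (rhoY_comm_le y x), fun x _ y hy z _ ↦
    rhoY_triangle hman hopen hy x z⟩
  · exact edist_eq_zero.1 (le_antisymm ((edist_le_rhoY x y).trans h.le) zero_le)
  · rintro rfl
    exact rhoY_self hman hx
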